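/- Let B be a self-adjoint Hilbert–Schmidt operator on a separable Hilbert space H with Id - B invertible, e ∈ H a unit vector and P the orthogonal projection onto e^⊥. Then ⟨e, (Id - B)^{-1} e⟩ = (det₂(Id - P B P) / det₂(Id - B)) · exp(⟨e, B e⟩), where det₂ denotes the Carleman–Fredholm determinant. -/

import Mathlib

open scoped RealInnerProductSpace Classical

/-- The orthogonal projection onto the orthogonal complement of `e`,
`P = Id - e ⊗ e` (for a unit vector `e`). -/
noncomputable def projPerp {H : Type*} [NormedAddCommGroup H] [InnerProductSpace ℝ H]
    (e : H) : H →L[ℝ] H :=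
  ContinuousLinearMap.id ℝ H - (innerSL ℝ e).smulRight e

/-- `B` is Hilbert–Schmidt and self-adjoint, witnessed by a spectral decomposition in a
Hilbert basis of eigenvectors with square-summable eigenvalues. -/
def IsHilbertSchmidtDiag {H : Type*} [NormedAddCommGroup H] [InnerProductSpace ℝ H]
    (B : H →L[ℝ] H) : Prop :=
  ∃ p : HilbertBasis ℕ ℝ H × (ℕ → ℝ),
    (∀ i, B (p.1 i) = p.2 i • p.1 i) ∧ Summable fun i => (p.2 i) ^ 2

/-- The Carleman–Fredholm determinant `det₂(Id - B) = ∏ᵢ (1 - μᵢ) exp(μᵢ)` over the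
eigenvalues `μᵢ` of a (self-adjoint, Hilbert–Schmidt) operator `B`; junk value `0`
otherwise. -/
noncomputable def carlemanFredholmDet {H : Type*} [NormedAddCommGroup H]
    [InnerProductSpace ℝ H] (B : H →L[ℝ] H) : ℝ :=
  if h : IsHilbertSchmidtDiag B then ∏' i, (1 - h.choose.2 i) * Real.exp (h.choose.2 i)
  else 0

section RegularizedProduct

/-- The Weierstrass product `∏ᵢ (1 - z νᵢ) exp(z νᵢ)` of genus one, as a function of `z`. -/
noncomputable def regularizedProd (ν : ℕ → ℝ) (z : ℂ) : ℂ :=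
  ∏' i, (1 - z * ν i) * Complex.exp (z * ν i)

lemma norm_one_sub_mul_exp_sub_one_le {w : ℂ} {M : ℝ} (hw : ‖w‖ ≤ M) :
    ‖(1 - w) * Complex.exp w - 1‖ ≤ ((1 + M) * Real.exp M + 1) * ‖w‖ ^ 2 := by
  have h := Complex.norm_exp_sub_sum_le_norm_mul_exp w 2
  simp only [Finset.sum_range_succ, Finset.sum_range_zero, pow_zero, pow_one, Nat.factorial,
    Nat.cast_one, div_one, zero_add, mul_one] at h
  have hM : 0 ≤ M := (norm_nonneg w).trans hw
  calc ‖(1 - w) * Complex.exp w - 1‖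
      = ‖(1 - w) * (Complex.exp w - (1 + w)) - w ^ 2‖ := by congr 1; ring
    _ ≤ ‖1 - w‖ * ‖Complex.exp w - (1 + w)‖ + ‖w‖ ^ 2 := by
        refine (norm_sub_le _ _).trans ?_
        rw [norm_mul, norm_pow]
    _ ≤ (1 + M) * (‖w‖ ^ 2 * Real.exp M) + ‖w‖ ^ 2 := by
        gcongr
        · refine (norm_sub_le _ _).trans ?_
          rw [norm_one]; gcongr
        · refine h.trans ?_
          gcongr
    _ = _ := by ring

lemma Summable.exists_bound_of_sq {ν : ℕ → ℝ} (hν : Summable fun i => ν i ^ 2) :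
    ∃ M, 0 ≤ M ∧ ∀ i, |ν i| ≤ M := by
  refine ⟨1 + ∑' i, ν i ^ 2, add_nonneg zero_le_one (tsum_nonneg fun i => sq_nonneg _),
    fun i => ?_⟩
  have h := hν.le_tsum i fun j _ => sq_nonneg _
  nlinarith [sq_abs (ν i), sq_nonneg (|ν i| - 1)]

lemma Summable.tendsto_zero_of_sq {ν : ℕ → ℝ} (hν : Summable fun i => ν i ^ 2) :
    Filter.Tendsto ν Filter.atTop (nhds 0) := by
  have h := hν.tendsto_atTop_zero.sqrt
  simp only [Real.sqrt_sq_eq_abs, Real.sqrt_zero] at h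
  exact (tendsto_zero_iff_abs_tendsto_zero _).2 h

lemma exists_regularizedProd_bound {ν : ℕ → ℝ} (hν : Summable fun i => ν i ^ 2) (R : ℝ) :
    ∃ C : ℝ, ∀ i, ∀ z ∈ Metric.ball (0 : ℂ) R,
      ‖(1 - z * ν i) * Complex.exp (z * ν i) - 1‖ ≤ C * ν i ^ 2 := by
  obtain ⟨M, hM0, hM⟩ := hν.exists_bound_of_sq
  refine ⟨((1 + R * M) * Real.exp (R * M) + 1) * R ^ 2, fun i z hz => ?_⟩
  rw [mem_ball_zero_iff] at hz
  have hR : 0 ≤ R := (norm_nonneg z).trans hz.le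
  have hn : ‖z * (ν i : ℂ)‖ = ‖z‖ * |ν i| := by simp
  refine (norm_one_sub_mul_exp_sub_one_le (M := R * M) ?_).trans ?_
  · rw [hn]; exact mul_le_mul hz.le (hM i) (abs_nonneg _) hR
  · rw [mul_assoc]
    gcongr
    rw [hn, mul_pow, sq_abs]
    gcongr

lemma summable_norm_regularizedProd {ν : ℕ → ℝ} (hν : Summable fun i => ν i ^ 2) (z : ℂ) :
    Summable fun i => ‖(1 - z * ν i) * Complex.exp (z * ν i) - 1‖ := by
  obtain ⟨C, hC⟩ := exists_regularizedProd_bound hν (‖z‖ + 1)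
  exact .of_nonneg_of_le (fun _ => norm_nonneg _) (fun i => hC i z (by simp)) (hν.mul_left C)

lemma hasProdLocallyUniformlyOn_regularizedProd {ν : ℕ → ℝ}
    (hν : Summable fun i => ν i ^ 2) (R : ℝ) :
    HasProdLocallyUniformlyOn (fun i (z : ℂ) => (1 - z * ν i) * Complex.exp (z * ν i))
      (regularizedProd ν) (Metric.ball 0 R) := by
  obtain ⟨C, hC⟩ := exists_regularizedProd_bound hν R
  have h := Summable.hasProdLocallyUniformlyOn_one_add (R := ℂ)
    (f := fun i (z : ℂ) => (1 - z * ν i) * Complex.exp (z * ν i) - 1)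
    Metric.isOpen_ball (hν.mul_left C) (.of_forall hC) (fun i => by fun_prop)
  simpa only [add_sub_cancel] using! h

lemma differentiable_regularizedProd {ν : ℕ → ℝ} (hν : Summable fun i => ν i ^ 2) :
    Differentiable ℂ (regularizedProd ν) := fun z => by
  have h : DifferentiableOn ℂ (regularizedProd ν) (Metric.ball 0 (‖z‖ + 1)) :=
    (hasProdLocallyUniformlyOn_regularizedProd hν _).differentiableOn
      (.of_forall fun s => DifferentiableOn.fun_finsetProd fun i _ => by fun_prop)
      Metric.isOpen_ball
  exact h.differentiableAt (Metric.isOpen_ball.mem_nhds (by simp))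

lemma regularizedProd_ne_zero {ν : ℕ → ℝ} (hν : Summable fun i => ν i ^ 2) {z : ℂ}
    (hz : ∀ i, 1 - z * ν i ≠ 0) : regularizedProd ν z ≠ 0 := by
  have h := tprod_one_add_ne_zero_of_summable
    (f := fun i => (1 - z * ν i) * Complex.exp (z * ν i) - 1)
    (fun i => by simpa using hz i) (summable_norm_regularizedProd hν z)
  simpa only [add_sub_cancel] using! h

lemma regularizedProd_zero (ν : ℕ → ℝ) : regularizedProd ν 0 = 1 := by
  simp [regularizedProd]

lemma regularizedProd_one {ν : ℕ → ℝ} (hν : Summable fun i => ν i ^ 2) :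
    regularizedProd ν 1 = ((∏' i, (1 - ν i) * Real.exp (ν i) : ℝ) : ℂ) := by
  have hs : Summable fun i => ‖(1 - ν i) * Real.exp (ν i) - 1‖ := by
    refine (summable_norm_regularizedProd hν 1).congr fun i => ?_
    rw [← Complex.norm_real]
    push_cast
    simp
  have hm := multipliable_one_add_of_summable hs
  simp only [add_sub_cancel] at hm
  have h := hm.map_tprod Complex.ofRealHom Complex.continuous_ofReal
  simp only [Complex.ofRealHom_eq_coe] at h
  rw [h, regularizedProd]
  simp

lemma logDeriv_regularizedProd {ν : ℕ → ℝ} (hν : Summable fun i => ν i ^ 2) {z : ℂ} {δ : ℝ}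
    (hδ : 0 < δ) (hz : ∀ i, δ ≤ ‖1 - z * ν i‖) :
    HasSum (fun i => (ν i - ν i / (1 - z * ν i) : ℂ)) (logDeriv (regularizedProd ν) z) := by
  have hz0 : ∀ i, 1 - z * ν i ≠ 0 := fun i => norm_pos_iff.1 (hδ.trans_le (hz i))
  have hl : ∀ i, logDeriv (fun z : ℂ => (1 - z * ν i) * Complex.exp (z * ν i)) z
      = ν i - ν i / (1 - z * ν i) := fun i => by
    have hd : HasDerivAt (fun z : ℂ => z * ν i) (ν i) z := by
      simpa using (hasDerivAt_id z).mul_const (ν i : ℂ)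
    have h := (hd.const_sub 1).mul hd.cexp
    rw [logDeriv_apply, show (fun z : ℂ => (1 - z * ν i) * Complex.exp (z * ν i)) =
      (fun z : ℂ => 1 - z * ν i) * fun z : ℂ => Complex.exp (z * ν i) from rfl, h.deriv]
    rw [div_eq_iff (mul_ne_zero (hz0 i) (Complex.exp_ne_zero _))]
    linear_combination Complex.exp (z * ν i) * div_mul_cancel₀ (ν i : ℂ) (hz0 i)
  have hs : Summable fun i => (ν i - ν i / (1 - z * ν i) : ℂ) := by
    refine .of_norm_bounded (hν.mul_left (‖z‖ / δ)) fun i => ?_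
    have he : (ν i - ν i / (1 - z * ν i) : ℂ) = -(z * ν i ^ 2) / (1 - z * ν i) := by
      rw [eq_div_iff (hz0 i), sub_mul, div_mul_cancel₀ _ (hz0 i)]
      ring
    rw [he, norm_div, norm_neg, norm_mul, norm_pow, Complex.norm_real, Real.norm_eq_abs, sq_abs,
      div_mul_eq_mul_div]
    gcongr
    exact hz i
  rw [hs.hasSum_iff]
  have hmem : z ∈ Metric.ball (0 : ℂ) (‖z‖ + 1) := by simp
  have h := logDeriv_tprod_eq_tsum Metric.isOpen_ball hmem
    (f := fun i (z : ℂ) => (1 - z * ν i) * Complex.exp (z * ν i))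
    (fun i => mul_ne_zero (hz0 i) (Complex.exp_ne_zero _)) (fun i => by fun_prop)
    (by simpa only [hl] using hs)
    (hasProdLocallyUniformlyOn_regularizedProd hν _).multipliableLocallyUniformlyOn
    (regularizedProd_ne_zero hν hz0)
  simp only [hl] at h
  exact h.symm

end RegularizedProduct

section ResolventSum

/-- The diagonal resolvent entry `∑ⱼ cⱼ / (1 - z μⱼ)`. -/
noncomputable def resolventSum (c μ : ℕ → ℝ) (z : ℂ) : ℂ := ∑' j, (c j : ℂ) / (1 - z * μ j)

lemma im_div_norm_le_norm_one_sub_mul_ofReal {z : ℂ} (hz : 0 < z.im) (x : ℝ) :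
    z.im / ‖z‖ ≤ ‖1 - z * x‖ := by
  have hz0 : z ≠ 0 := by rintro rfl; simp at hz
  have h : z.im ≤ ‖z‖ * ‖1 - z * x‖ := by
    calc z.im ≤ |(starRingEnd ℂ z * (1 - z * x)).im| := by
          rw [← abs_neg]
          refine le_trans (le_of_eq ?_) (le_abs_self _)
          simp
          ring
      _ ≤ _ := by simpa using Complex.abs_im_le_norm (starRingEnd ℂ z * (1 - z * x))
  rw [div_le_iff₀ (norm_pos_iff.2 hz0)]
  linarith

lemma one_sub_mul_ofReal_ne_zero {z : ℂ} (hz : 0 < z.im) (x : ℝ) : 1 - z * x ≠ 0 := by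
  have hz0 : z ≠ 0 := by rintro rfl; simp at hz
  exact norm_pos_iff.1 ((div_pos hz (norm_pos_iff.2 hz0)).trans_le
    (im_div_norm_le_norm_one_sub_mul_ofReal hz x))

variable {c μ : ℕ → ℝ}

lemma norm_div_one_sub_mul_le (hc0 : ∀ j, 0 ≤ c j) {δ : ℝ} (hδ : 0 < δ) {z : ℂ} {j : ℕ}
    (hz : δ ≤ ‖1 - z * μ j‖) : ‖(c j : ℂ) / (1 - z * μ j)‖ ≤ δ⁻¹ * c j := by
  rw [norm_div, Complex.norm_real, Real.norm_of_nonneg (hc0 j), div_eq_inv_mul]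
  gcongr
  exact hc0 j

lemma summable_resolventSum (hc0 : ∀ j, 0 ≤ c j) (hc : Summable c) {δ : ℝ} (hδ : 0 < δ) {z : ℂ}
    (hz : ∀ j, δ ≤ ‖1 - z * μ j‖) : Summable fun j => (c j : ℂ) / (1 - z * μ j) :=
  .of_norm_bounded (hc.mul_left δ⁻¹) fun j => norm_div_one_sub_mul_le hc0 hδ (hz j)

lemma differentiableOn_resolventSum (hc0 : ∀ j, 0 ≤ c j) (hc : Summable c) {δ : ℝ} (hδ : 0 < δ)
    {U : Set ℂ} (hU : IsOpen U) (hUδ : ∀ z ∈ U, ∀ j, δ ≤ ‖1 - z * μ j‖) :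
    DifferentiableOn ℂ (resolventSum c μ) U := by
  refine Complex.differentiableOn_tsum_of_summable_norm (hc.mul_left δ⁻¹) (fun j => ?_) hU
    fun j z hz => norm_div_one_sub_mul_le hc0 hδ (hUδ z hz j)
  have h : ∀ z ∈ U, 1 - z * (μ j : ℂ) ≠ 0 := fun z hz =>
    norm_pos_iff.1 (hδ.trans_le (hUδ z hz j))
  fun_prop (disch := assumption)

lemma hasSum_resolventSum_add_mul_deriv (hc0 : ∀ j, 0 ≤ c j) (hc : Summable c) {δ : ℝ}
    (hδ : 0 < δ) {U : Set ℂ} (hU : IsOpen U) (hUδ : ∀ z ∈ U, ∀ j, δ ≤ ‖1 - z * μ j‖)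
    {z : ℂ} (hz : z ∈ U) :
    HasSum (fun j => (c j : ℂ) / (1 - z * μ j) ^ 2)
      (resolventSum c μ z + z * deriv (resolventSum c μ) z) := by
  have h0 : ∀ j, ∀ z ∈ U, 1 - z * (μ j : ℂ) ≠ 0 := fun j z hz =>
    norm_pos_iff.1 (hδ.trans_le (hUδ z hz j))
  have hd := Complex.hasSum_deriv_of_summable_norm (F := fun j (z : ℂ) => (c j : ℂ) / (1 - z * μ j))
    (hc.mul_left δ⁻¹) (fun j => by have := h0 j; fun_prop (disch := assumption)) hU
    (fun j z hz => norm_div_one_sub_mul_le hc0 hδ (hUδ z hz j)) hz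
  refine ((summable_resolventSum hc0 hc hδ (hUδ z hz)).hasSum.add
    (hd.mul_left z)).congr_fun fun j => ?_
  have hj := h0 j z hz
  have hd1 : HasDerivAt (fun z : ℂ => 1 - z * μ j) (-(μ j)) z := by
    simpa using ((hasDerivAt_id z).mul_const (μ j : ℂ)).const_sub 1
  have hd2 := (hasDerivAt_const z (c j : ℂ)).fun_div hd1 hj
  rw [hd2.deriv]
  field_simp
  ring

lemma resolventSum_ne_zero (hc0 : ∀ j, 0 ≤ c j) (hc : HasSum c 1) {z : ℂ} (hz : 0 < z.im) :
    resolventSum c μ z ≠ 0 := by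
  have hz0 : z ≠ 0 := by rintro rfl; simp at hz
  have hδ : 0 < z.im / ‖z‖ := div_pos hz (norm_pos_iff.2 hz0)
  have hb := im_div_norm_le_norm_one_sub_mul_ofReal hz
  have hs := (summable_resolventSum hc0 hc.summable hδ fun j => hb (μ j)).hasSum
  intro h0
  change HasSum _ (resolventSum c μ z) at hs
  rw [h0] at hs
  have hn : ∀ j, 0 < Complex.normSq (1 - z * μ j) := fun j =>
    Complex.normSq_pos.2 (one_sub_mul_ofReal_ne_zero hz _)
  -- the combination `re + (re z / im z) im` of the sum has the terms `cⱼ / |1 - z μⱼ|²`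
  have h1 := (Complex.hasSum_re hs).add ((Complex.hasSum_im hs).mul_left (z.re / z.im))
  have h2 : HasSum (fun j => c j / Complex.normSq (1 - z * μ j)) 0 := by
    refine (by simpa using h1 : HasSum _ (0 : ℝ)).congr_fun fun j => ?_
    have := (hn j).ne'
    simp [Complex.div_re, Complex.div_im]
    field_simp
    ring
  have h3 := (hasSum_zero_iff_of_nonneg fun j => div_nonneg (hc0 j) (hn j).le).1 h2
  have h4 : c = 0 := funext fun j => by
    simpa [(hn j).ne'] using congrFun h3 j
  rw [h4] at hc
  exact zero_ne_one (hasSum_zero.unique hc)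

lemma tendsto_resolventSum (hc0 : ∀ j, 0 ≤ c j) (hc : Summable c) {δ : ℝ} (hδ : 0 < δ)
    {α : Type*} {l : Filter α} {u : α → ℂ} {z : ℂ} (hu : Filter.Tendsto u l (nhds z))
    (hul : ∀ᶠ x in l, ∀ j, δ ≤ ‖1 - u x * μ j‖) (hz : ∀ j, δ ≤ ‖1 - z * μ j‖) :
    Filter.Tendsto (fun x => resolventSum c μ (u x)) l (nhds (resolventSum c μ z)) := by
  refine tendsto_tsum_of_dominated_convergence (hc.mul_left δ⁻¹) (fun j => ?_) ?_
  · exact tendsto_const_nhds.div (tendsto_const_nhds.sub (hu.mul_const _))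
      (norm_pos_iff.1 (hδ.trans_le (hz j)))
  · filter_upwards [hul] with x hx j using norm_div_one_sub_mul_le hc0 hδ (hx j)

end ResolventSum

section Diagonalization

variable {H : Type*} [NormedAddCommGroup H] [InnerProductSpace ℝ H]

lemma HilbertBasis.hasSum_inner_sq {ι : Type*} (b : HilbertBasis ι ℝ H) (x : H) :
    HasSum (fun i => ⟪b i, x⟫ ^ 2) (‖x‖ ^ 2) := by
  rw [← real_inner_self_eq_norm_sq]
  refine (b.hasSum_inner_mul_inner x x).congr_fun fun i => ?_
  rw [real_inner_comm x, sq]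

lemma inner_apply_of_eigenvector {B : H →L[ℝ] H} (hsym : ∀ f g : H, ⟪B f, g⟫ = ⟪f, B g⟫)
    {v : H} {μ : ℝ} (hv : B v = μ • v) (x : H) : ⟪v, B x⟫ = μ * ⟪v, x⟫ := by
  rw [← hsym, hv, real_inner_smul_left]

lemma isCompactOperator_of_hilbertBasis [CompleteSpace H] {B : H →L[ℝ] H}
    (hsym : ∀ f g : H, ⟪B f, g⟫ = ⟪f, B g⟫) (b : HilbertBasis ℕ ℝ H) {μ : ℕ → ℝ}
    (hb : ∀ i, B (b i) = μ i • b i) (hμ : Filter.Tendsto μ Filter.atTop (nhds 0)) :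
    IsCompactOperator B := by
  let F : ℕ → H →L[ℝ] H := fun n =>
    ∑ i ∈ Finset.range n, (innerSL ℝ (b i)).smulRight (μ i • b i)
  have hF : ∀ n, IsCompactOperator (F n) := fun n => by
    refine sum_mem (S := compactOperator (RingHom.id ℝ) H H) fun i _ => ?_
    have h : IsCompactOperator (innerSL ℝ (b i)) :=
      isCompactOperator_of_locallyCompactSpace_dom _
    exact h.clm_comp (ContinuousLinearMap.toSpanSingleton ℝ (μ i • b i))
  have hFb : ∀ n j x, ⟪b j, (B - F n) x⟫ = if j < n then 0 else μ j * ⟪b j, x⟫ := by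
    intro n j x
    simp only [F, sub_apply, inner_sub_right, sum_apply,
      ContinuousLinearMap.smulRight_apply, innerSL_apply_apply, inner_sum, real_inner_smul_right,
      inner_apply_of_eigenvector hsym (hb j), orthonormal_iff_ite.1 b.orthonormal]
    simp
    split_ifs <;> grind
  refine isCompactOperator_of_tendsto (l := Filter.atTop) (F := F) ?_ (.of_forall hF)
  rw [Metric.tendsto_atTop]
  intro ε hε
  obtain ⟨N, hN⟩ := Metric.tendsto_atTop.1 hμ (ε / 2) (half_pos hε)
  refine ⟨N, fun n hn => ?_⟩
  rw [dist_comm, dist_eq_norm]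
  refine (ContinuousLinearMap.opNorm_le_bound _ (half_pos hε).le fun x => ?_).trans_lt
    (half_lt_self hε)
  refine le_of_sq_le_sq ?_ (by positivity)
  rw [mul_pow]
  refine hasSum_le (fun j => ?_) (b.hasSum_inner_sq ((B - F n) x))
    ((b.hasSum_inner_sq x).mul_left ((ε / 2) ^ 2))
  rw [hFb]
  split_ifs with hj
  · rw [zero_pow two_ne_zero]
    positivity
  · rw [mul_pow]
    refine mul_le_mul_of_nonneg_right ?_ (sq_nonneg _)
    have := hN j (by omega)
    rw [Real.dist_eq, sub_zero] at this
    exact sq_le_sq' (by linarith [(abs_lt.1 this).1]) (abs_lt.1 this).2.le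

lemma HilbertBasis.countable_index {ι : Type*} (b : HilbertBasis ℕ ℝ H) (f : HilbertBasis ι ℝ H) :
    Countable ι := by
  rw [← Set.countable_univ_iff]
  have h : (Set.univ : Set ι) ⊆ ⋃ j, Function.support fun i => ⟪f i, b j⟫ ^ 2 := fun i _ => by
    by_contra hi
    simp only [Set.mem_iUnion, Function.mem_support, not_exists, not_not] at hi
    have h0 := b.hasSum_inner_sq (f i)
    simp only [real_inner_comm, hi] at h0
    have := hasSum_zero.unique h0
    rw [f.orthonormal.1 i] at this
    norm_num at this
  exact (Set.countable_iUnion fun j => (f.hasSum_inner_sq (b j)).summable.countable_support).mono h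

lemma HilbertBasis.infinite_index {ι : Type*} (b : HilbertBasis ℕ ℝ H) (f : HilbertBasis ι ℝ H) :
    Infinite ι := by
  by_contra h
  have : Fintype ι := fintypeOfNotInfinite h
  have : FiniteDimensional ℝ H := f.toOrthonormalBasis.toBasis.finiteDimensional_of_finite
  have := b.orthonormal.linearIndependent.finite
  exact not_finite ℕ

lemma exists_hilbertBasis_eigenvectors [CompleteSpace H] (b : HilbertBasis ℕ ℝ H) {T : H →L[ℝ] H}
    (hT : IsCompactOperator T) (hT' : T.IsSymmetric) :
    ∃ p : HilbertBasis ℕ ℝ H × (ℕ → ℝ), ∀ i, T (p.1 i) = p.2 i • p.1 i := by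
  let V : ℝ → Submodule ℝ H := fun μ => Module.End.eigenspace (T : Module.End ℝ H) μ
  have hVc : ∀ μ, CompleteSpace (V μ) := fun μ => by
    refine IsClosed.completeSpace_coe (hs := ?_)
    have h : (V μ : Set H) = {x | T x = μ • x} := by
      ext x; simp [V]
    rw [h]
    exact isClosed_eq T.continuous (continuous_const_smul μ)
  choose w f hf using fun μ => exists_hilbertBasis ℝ (V μ)
  have hV : OrthogonalFamily ℝ (fun μ => V μ) fun μ => (V μ).subtypeₗᵢ :=
    hT'.orthogonalFamily_eigenspaces
  have hon := hV.orthonormal_sigma_orthonormal fun μ => (f μ).orthonormal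
  have hsp : (Submodule.span ℝ (Set.range fun a : Σ μ, w μ =>
      (V a.1).subtypeₗᵢ (f a.1 a.2)))ᗮ = ⊥ := by
    rw [eq_bot_iff, ← ContinuousLinearMap.orthogonalComplement_iSup_eigenspaces_eq_bot hT hT']
    intro x hx
    rw [← Submodule.iInf_orthogonal, Submodule.mem_iInf]
    intro μ
    rw [Submodule.mem_orthogonal]
    intro v hv
    have hs := ((f μ).hasSum_repr ⟨v, hv⟩).mapL ((innerSL ℝ x).comp (V μ).subtypeL)
    rw [real_inner_comm]
    refine hs.unique (hasSum_zero.congr_fun fun i => ?_)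
    have := (Submodule.mem_orthogonal' _ _).1 hx _ (Submodule.subset_span ⟨⟨μ, i⟩, rfl⟩)
    simp only [Submodule.coe_subtypeₗᵢ, Submodule.subtype_apply] at this
    simp [this]
  let g := HilbertBasis.mkOfOrthogonalEqBot hon hsp
  have := b.countable_index g
  have := b.infinite_index g
  obtain ⟨e⟩ := nonempty_equiv_of_countable (α := ℕ) (β := Σ μ, w μ)
  have hon' := hon.comp e e.injective
  have hr : Set.range ((fun a : Σ μ, w μ => (V a.1).subtypeₗᵢ (f a.1 a.2)) ∘ e)
      = Set.range fun a : Σ μ, w μ => (V a.1).subtypeₗᵢ (f a.1 a.2) := e.surjective.range_comp _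
  refine ⟨(HilbertBasis.mkOfOrthogonalEqBot hon' (by rw [hr]; exact hsp), fun i => (e i).1),
    fun i => ?_⟩
  rw [HilbertBasis.coe_mkOfOrthogonalEqBot]
  exact Module.End.mem_eigenspace_iff.1 (f (e i).1 (e i).2).2

end Diagonalization

section ChangeOfBasis

variable {H : Type*} [NormedAddCommGroup H] [InnerProductSpace ℝ H] {ι κ : Type*}

/-- Basis independence of the trace of a diagonal trace-class operator. -/
lemma HilbertBasis.hasSum_tsum_inner_sq_smul {E : Type*} [NormedAddCommGroup E] [NormedSpace ℝ E]
    [CompleteSpace E] (b : HilbertBasis ι ℝ H) (f : HilbertBasis κ ℝ H) {a : ι → E}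
    (ha : Summable fun j => ‖a j‖) :
    HasSum (fun i => ∑' j, (⟪b j, f i⟫ ^ 2) • a j) (∑' j, a j) := by
  have h1 : ∀ j, HasSum (fun i => ⟪b j, f i⟫ ^ 2) 1 := fun j => by
    have h := f.hasSum_inner_sq (b j)
    simpa only [real_inner_comm, b.orthonormal.1 j, one_pow] using h
  have hF : Summable fun p : ι × κ => (⟪b p.1, f p.2⟫ ^ 2) • a p.1 := by
    refine .of_norm ((summable_prod_of_nonneg fun _ => norm_nonneg _).2 ⟨fun j => ?_, ?_⟩)
    · simpa only [norm_smul, norm_pow, Real.norm_eq_abs, sq_abs] using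
        (h1 j).summable.mul_right ‖a j‖
    · refine ha.congr fun j => ?_
      simp only [norm_smul, norm_pow, Real.norm_eq_abs, sq_abs]
      rw [tsum_mul_right, (h1 j).tsum_eq, one_mul]
  have h2 : HasSum a (∑' p : ι × κ, (⟪b p.1, f p.2⟫ ^ 2) • a p.1) :=
    hF.hasSum.prod_fiberwise fun j => by simpa using (h1 j).smul_const (a j)
  rw [h2.tsum_eq, ← (Equiv.prodComm κ ι).tsum_eq]
  exact hF.prod_symm.hasSum.prod_fiberwise fun i => (hF.prod_symm.prod_factor i).hasSum

/-- The bilinear square of `u + i v` in the complexification, computed in a Hilbert basis. -/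
lemma HilbertBasis.hasSum_inner_add_inner_mul_I_sq (g : HilbertBasis ι ℝ H) (u v : H) :
    HasSum (fun i => ((⟪g i, u⟫ : ℂ) + ⟪g i, v⟫ * Complex.I) ^ 2)
      ((⟪u, u⟫ - ⟪v, v⟫ : ℂ) + 2 * Complex.I * ⟪u, v⟫) := by
  have h1 := Complex.hasSum_ofReal.2 (g.hasSum_inner_mul_inner u u)
  have h2 := Complex.hasSum_ofReal.2 (g.hasSum_inner_mul_inner v v)
  have h3 := Complex.hasSum_ofReal.2 (g.hasSum_inner_mul_inner u v)
  refine ((h1.sub h2).add (h3.mul_left (2 * Complex.I))).congr_fun fun i => ?_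
  rw [real_inner_comm (g i) u, real_inner_comm (g i) v]
  push_cast
  linear_combination (⟪g i, v⟫ : ℂ) ^ 2 * Complex.I_sq

/-- Parseval's identity for the complex bilinear extension of the inner product. -/
lemma HilbertBasis.exists_hasSum_complex_sq (b : HilbertBasis ι ℝ H) (f : HilbertBasis κ ℝ H)
    {s : ι → ℂ} (hs : Summable fun j => ‖s j‖ ^ 2) :
    ∃ S : κ → ℂ, (∀ i, HasSum (fun j => (⟪f i, b j⟫ : ℂ) * s j) (S i)) ∧
      HasSum (fun i => S i ^ 2) (∑' j, s j ^ 2) := by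
  have hmem : ∀ r : ι → ℝ, (∀ j, |r j| ≤ ‖s j‖) → ∃ u : H, ∀ j, ⟪b j, u⟫ = r j := fun r hr => by
    have h : Memℓp r 2 := memℓp_gen (by
      simp only [ENNReal.toReal_ofNat, Real.rpow_ofNat, Real.norm_eq_abs]
      exact hs.of_nonneg_of_le (fun _ => by positivity) fun j => by gcongr; exact hr j)
    exact ⟨b.repr.symm ⟨r, h⟩, fun j => by simp [← b.repr_apply_apply]⟩
  obtain ⟨u, hu⟩ := hmem (fun j => (s j).re) fun j => Complex.abs_re_le_norm _
  obtain ⟨v, hv⟩ := hmem (fun j => (s j).im) fun j => Complex.abs_im_le_norm _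
  refine ⟨fun i => (⟪f i, u⟫ : ℂ) + ⟪f i, v⟫ * Complex.I, fun i => ?_, ?_⟩
  · have h1 := Complex.hasSum_ofReal.2 (b.hasSum_inner_mul_inner (f i) u)
    have h2 := Complex.hasSum_ofReal.2 (b.hasSum_inner_mul_inner (f i) v)
    refine (h1.add (h2.mul_right Complex.I)).congr_fun fun j => ?_
    rw [hu, hv]
    push_cast
    linear_combination -(⟪f i, b j⟫ : ℂ) * Complex.re_add_im (s j)
  · have h := (b.hasSum_inner_add_inner_mul_I_sq u v).tsum_eq
    simp only [hu, hv, Complex.re_add_im] at h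
    rw [h]
    exact f.hasSum_inner_add_inner_mul_I_sq u v

end ChangeOfBasis

section Compression

variable {H : Type*} [NormedAddCommGroup H] [InnerProductSpace ℝ H]

lemma projPerp_apply (e x : H) : projPerp e x = x - ⟪e, x⟫ • e := by
  simp [projPerp]

lemma inner_projPerp_left (e x y : H) : ⟪projPerp e x, y⟫ = ⟪x, projPerp e y⟫ := by
  simp only [projPerp_apply, inner_sub_left, inner_sub_right, real_inner_smul_left,
    real_inner_smul_right, real_inner_comm e x]
  ring

lemma inner_projPerp_self {e : H} (he : ‖e‖ = 1) (x : H) : ⟪e, projPerp e x⟫ = 0 := by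
  simp [projPerp_apply, inner_sub_right, real_inner_smul_right, he]

variable {B : H →L[ℝ] H} {e v : H} {l : ℝ}

lemma eigenvalue_compression_mul_inner (he : ‖e‖ = 1)
    (hv : (projPerp e).comp (B.comp (projPerp e)) v = l • v) : l * ⟪e, v⟫ = 0 := by
  rw [← real_inner_smul_right, ← hv]
  exact inner_projPerp_self he _

lemma apply_projPerp_of_eigenvector
    (hv : (projPerp e).comp (B.comp (projPerp e)) v = l • v) :
    B (v - ⟪e, v⟫ • e) = l • v + ⟪e, B (v - ⟪e, v⟫ • e)⟫ • e := by
  simp only [ContinuousLinearMap.comp_apply, projPerp_apply] at hv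
  rw [← hv]
  simp

lemma inner_apply_sub_eigenvalue_compression (hsym : ∀ f g : H, ⟪B f, g⟫ = ⟪f, B g⟫)
    (hv1 : ‖v‖ = 1) (hv : (projPerp e).comp (B.comp (projPerp e)) v = l • v) :
    ⟪v, B v⟫ - l = 2 * (⟪e, v⟫ * ⟪v, B e⟫) - ⟪e, B e⟫ * ⟪e, v⟫ ^ 2 := by
  have h := congrArg (fun x => ⟪v, x⟫) (apply_projPerp_of_eigenvector hv)
  have h2 : ⟪e, B v⟫ = ⟪v, B e⟫ := by rw [← hsym, real_inner_comm]
  simp only [map_sub, map_smul, inner_sub_right, inner_add_right, real_inner_smul_right, h2,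
    real_inner_self_eq_norm_sq, hv1, real_inner_comm e v] at h
  linear_combination h

lemma abs_eigenvalue_compression_le (hsym : ∀ f g : H, ⟪B f, g⟫ = ⟪f, B g⟫) (he : ‖e‖ = 1)
    (hv1 : ‖v‖ = 1) (hv : (projPerp e).comp (B.comp (projPerp e)) v = l • v) :
    |l| ≤ ‖B v‖ := by
  rcases mul_eq_zero.1 (eigenvalue_compression_mul_inner he hv) with h | h
  · simp [h]
  · have h2 := inner_apply_sub_eigenvalue_compression hsym hv1 hv
    rw [h] at h2
    have h3 : l = ⟪v, B v⟫ := by linarith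
    rw [h3]
    simpa [hv1] using abs_real_inner_le_norm v (B v)

lemma summable_sq_eigenvalues_compression (hsym : ∀ f g : H, ⟪B f, g⟫ = ⟪f, B g⟫)
    (b : HilbertBasis ℕ ℝ H) {μ : ℕ → ℝ} (hb : ∀ i, B (b i) = μ i • b i)
    (hμ : Summable fun i => μ i ^ 2) (he : ‖e‖ = 1) (f : HilbertBasis ℕ ℝ H) {l : ℕ → ℝ}
    (hf : ∀ i, (projPerp e).comp (B.comp (projPerp e)) (f i) = l i • f i) :
    Summable fun i => l i ^ 2 := by
  have h := b.hasSum_tsum_inner_sq_smul f (a := fun j => μ j ^ 2) (by simpa using hμ)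
  refine h.summable.of_nonneg_of_le (fun _ => sq_nonneg _) fun i => ?_
  have h2 := b.hasSum_inner_sq (B (f i))
  simp only [inner_apply_of_eigenvector hsym (hb _)] at h2
  have h3 : ∑' j, ⟪b j, f i⟫ ^ 2 • μ j ^ 2 = ‖B (f i)‖ ^ 2 := by
    rw [← h2.tsum_eq]
    exact tsum_congr fun j => by rw [smul_eq_mul]; ring
  rw [h3, ← sq_abs]
  gcongr
  exact abs_eigenvalue_compression_le hsym he (f.orthonormal.1 i) (hf i)

lemma isHilbertSchmidtDiag_compression [CompleteSpace H]
    (hsym : ∀ f g : H, ⟪B f, g⟫ = ⟪f, B g⟫) (hhs : IsHilbertSchmidtDiag B) (he : ‖e‖ = 1) :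
    IsHilbertSchmidtDiag ((projPerp e).comp (B.comp (projPerp e))) := by
  obtain ⟨⟨b, μ⟩, hb, hμ⟩ := hhs
  have hT : IsCompactOperator ((projPerp e).comp (B.comp (projPerp e))) :=
    ((isCompactOperator_of_hilbertBasis hsym b hb hμ.tendsto_zero_of_sq).comp_clm
      (projPerp e)).clm_comp (projPerp e)
  have hT' : ((projPerp e).comp (B.comp (projPerp e))).IsSymmetric := fun x y => by
    simp only [ContinuousLinearMap.coe_coe, ContinuousLinearMap.comp_apply, inner_projPerp_left,
      hsym]
  obtain ⟨p, hp⟩ := exists_hilbertBasis_eigenvectors b hT hT'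
  exact ⟨p, hp, summable_sq_eigenvalues_compression hsym b hb hμ he p.1 hp⟩

/-- The Schur complement formula for the resolvent of a compression, on an eigenvector `v`. -/
lemma inv_one_sub_mul_eigenvalue_compression (hsym : ∀ f g : H, ⟪B f, g⟫ = ⟪f, B g⟫)
    (b : HilbertBasis ℕ ℝ H) {μ : ℕ → ℝ} (hb : ∀ i, B (b i) = μ i • b i)
    (he : ‖e‖ = 1) (hv1 : ‖v‖ = 1)
    (hv : (projPerp e).comp (B.comp (projPerp e)) v = l • v) {z : ℂ}
    (hz : ∀ j, 1 - z * μ j ≠ 0) (hzl : 1 - z * l ≠ 0) {W S g : ℂ} (hg : g ≠ 0)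
    (hW : HasSum (fun j => (⟪b j, v⟫ : ℂ) ^ 2 / (1 - z * μ j)) W)
    (hS : HasSum (fun j => (⟪b j, v⟫ * ⟪b j, e⟫ : ℂ) / (1 - z * μ j)) S)
    (hG : HasSum (fun j => (⟪b j, e⟫ : ℂ) ^ 2 / (1 - z * μ j)) g) :
    (1 - z * l)⁻¹ = W - S ^ 2 / g + (⟪e, v⟫ : ℂ) ^ 2 := by
  set k : ℝ := ⟪e, v⟫ with hk
  set m : ℝ := ⟪e, B (v - k • e)⟫ with hm
  have hcomp : ∀ j, μ j * (⟪b j, v⟫ - k * ⟪b j, e⟫) = l * ⟪b j, v⟫ + m * ⟪b j, e⟫ := fun j => by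
    have h := congrArg (fun x => ⟪b j, x⟫) (apply_projPerp_of_eigenvector hv)
    simp only [← hk, ← hm] at h
    simpa only [inner_apply_of_eigenvector hsym (hb j), inner_add_right, inner_sub_right,
      real_inner_smul_right] using h
  have hd : ∀ j, ((⟪b j, v⟫ : ℂ) - k * ⟪b j, e⟫) =
      (1 - z * l) * (⟪b j, v⟫ / (1 - z * μ j)) - (k + z * m) * (⟪b j, e⟫ / (1 - z * μ j)) :=
    fun j => by
      have h := congrArg ((↑) : ℝ → ℂ) (hcomp j)
      push_cast at h
      rw [← mul_div_assoc, ← mul_div_assoc, ← sub_div, eq_div_iff (hz j)]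
      linear_combination -z * h
  have hkl : (l : ℂ) * k = 0 := by exact_mod_cast eigenvalue_compression_mul_inner he hv
  have hev := Complex.hasSum_ofReal.2 (b.hasSum_inner_mul_inner e v)
  have hee := Complex.hasSum_ofReal.2 (b.hasSum_inner_mul_inner e e)
  have hvv := Complex.hasSum_ofReal.2 (b.hasSum_inner_mul_inner v v)
  rw [real_inner_self_eq_norm_sq, he] at hee
  rw [real_inner_self_eq_norm_sq, hv1] at hvv
  have h1 : (1 - z * l) * S - (k + z * m) * g = k - k * 1 := by
    refine ((hS.mul_left _).sub (hG.mul_left _)).unique ?_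
    have h := hev.sub (hee.mul_left (k : ℂ))
    simp only [one_pow, Complex.ofReal_one] at h
    refine h.congr_fun fun j => ?_
    rw [real_inner_comm (b j) e]
    push_cast
    linear_combination -(⟪b j, e⟫ : ℂ) * hd j
  have h2 : (1 - z * l) * W - (k + z * m) * S = 1 - k * k := by
    refine ((hW.mul_left _).sub (hS.mul_left _)).unique ?_
    have h := hvv.sub (hev.mul_left (k : ℂ))
    simp only [one_pow, Complex.ofReal_one] at h
    refine h.congr_fun fun j => ?_
    rw [real_inner_comm (b j) e, real_inner_comm (b j) v]
    push_cast
    linear_combination -(⟪b j, v⟫ : ℂ) * hd j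
  rw [inv_eq_iff_eq_inv, eq_comm, inv_eq_iff_eq_inv, eq_comm, ← one_div, div_eq_iff hzl]
  field_simp
  linear_combination -g * h2 + S * h1 + z * k * g * hkl

end Compression

section CramerRule

variable {H : Type*} [NormedAddCommGroup H] [InnerProductSpace ℝ H]
  {B : H →L[ℝ] H} {e : H} {b f : HilbertBasis ℕ ℝ H} {μ l : ℕ → ℝ}

/-- The trace of the difference of the regularized resolvents of the compression and of `B`. -/
lemma hasSum_regularized_resolvent_compression (hsym : ∀ f g : H, ⟪B f, g⟫ = ⟪f, B g⟫)
    (hb : ∀ i, B (b i) = μ i • b i) (he : ‖e‖ = 1)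
    (hf : ∀ i, (projPerp e).comp (B.comp (projPerp e)) (f i) = l i • f i) {z : ℂ} {δ : ℝ}
    (hδ : 0 < δ) (hz : ∀ j, δ ≤ ‖1 - z * μ j‖) (hzl : ∀ i, 1 - z * l i ≠ 0) {T g q : ℂ}
    (hg : g ≠ 0) (hT : HasSum (fun j => (1 - z * μ j)⁻¹ - 1 - z * μ j) T)
    (hG : HasSum (fun j => (⟪b j, e⟫ : ℂ) ^ 2 / (1 - z * μ j)) g)
    (hq : HasSum (fun j => (⟪b j, e⟫ : ℂ) ^ 2 / (1 - z * μ j) ^ 2) q) :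
    HasSum (fun i => (1 - z * l i)⁻¹ - 1 - z * l i) (T - q / g + 1 + z * ⟪e, B e⟫) := by
  have hz0 : ∀ j, 1 - z * μ j ≠ 0 := fun j => norm_pos_iff.1 (hδ.trans_le (hz j))
  obtain ⟨S, hS, hSq⟩ := b.exists_hasSum_complex_sq f
    (s := fun j => (⟪b j, e⟫ : ℂ) / (1 - z * μ j)) (by
      refine ((b.hasSum_inner_sq e).summable.mul_left (δ⁻¹ ^ 2)).of_nonneg_of_le
        (fun _ => by positivity) fun j => ?_
      rw [← sq_abs (⟪b j, e⟫), ← mul_pow, norm_div, Complex.norm_real, Real.norm_eq_abs,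
        div_eq_inv_mul]
      gcongr
      exact hz j)
  simp only [div_pow, hq.tsum_eq] at hSq
  have htr := b.hasSum_tsum_inner_sq_smul f hT.summable.norm
  rw [hT.tsum_eq] at htr
  have hk := Complex.hasSum_ofReal.2 (f.hasSum_inner_sq e)
  have hBe := Complex.hasSum_ofReal.2 (f.hasSum_inner_mul_inner e (B e))
  rw [he] at hk
  have htot := ((htr.sub (hSq.div_const g)).add hk).add
    (((hBe.mul_left 2).sub (hk.mul_left (⟪e, B e⟫ : ℂ))).mul_left z)
  have hval : T - q / g + 1 + z * ⟪e, B e⟫ = T - q / g + ((1 ^ 2 : ℝ) : ℂ) +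
      z * (2 * ⟪e, B e⟫ - ⟪e, B e⟫ * ((1 ^ 2 : ℝ) : ℂ)) := by push_cast; ring
  rw [hval]
  refine htot.congr_fun fun i => ?_
  have hB := b.hasSum_inner_mul_inner (f i) (B (f i))
  have h1 := b.hasSum_inner_sq (f i)
  rw [f.orthonormal.1 i] at h1
  have hW0 : Summable fun j => (⟪b j, f i⟫ : ℂ) ^ 2 / (1 - z * μ j) := by
    refine .of_norm_bounded (h1.summable.mul_left δ⁻¹) fun j => ?_
    rw [norm_div, norm_pow, Complex.norm_real, Real.norm_eq_abs, sq_abs, div_eq_inv_mul]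
    gcongr
    exact hz j
  have hW : ∑' j, ⟪b j, f i⟫ ^ 2 • ((1 - z * μ j)⁻¹ - 1 - z * μ j) =
      (∑' j, (⟪b j, f i⟫ : ℂ) ^ 2 / (1 - z * μ j)) - 1 - z * ⟪f i, B (f i)⟫ := by
    have h := (hW0.hasSum.sub (Complex.hasSum_ofReal.2 h1)).sub
      ((Complex.hasSum_ofReal.2 hB).mul_left z)
    rw [one_pow, Complex.ofReal_one] at h
    rw [← h.tsum_eq]
    refine tsum_congr fun j => ?_
    rw [inner_apply_of_eigenvector hsym (hb j), real_inner_comm (b j) (f i), Complex.real_smul]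
    push_cast
    ring
  have hres := inv_one_sub_mul_eigenvalue_compression hsym b hb he (f.orthonormal.1 i) (hf i) hz0
    (hzl i) hg hW0.hasSum ((hS i).congr_fun fun j => by
      rw [real_inner_comm (b j) (f i), mul_div_assoc]) hG
  have hdiag := congrArg ((↑) : ℝ → ℂ)
    (inner_apply_sub_eigenvalue_compression hsym (f.orthonormal.1 i) (hf i))
  push_cast at hdiag
  rw [hW, hres, real_inner_comm e (f i)]
  push_cast
  linear_combination z * hdiag

lemma logDeriv_resolventSum_compression (hsym : ∀ f g : H, ⟪B f, g⟫ = ⟪f, B g⟫)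
    (hb : ∀ i, B (b i) = μ i • b i) (hμ : Summable fun i => μ i ^ 2) (he : ‖e‖ = 1)
    (hf : ∀ i, (projPerp e).comp (B.comp (projPerp e)) (f i) = l i • f i) {z : ℂ} {δ : ℝ}
    (hδ : 0 < δ) {U : Set ℂ} (hU : IsOpen U) (hUδ : ∀ z ∈ U, ∀ x : ℝ, δ ≤ ‖1 - z * x‖)
    (hzU : z ∈ U) (hz : 0 < z.im) :
    logDeriv (regularizedProd l) z = logDeriv (regularizedProd μ) z +
      logDeriv (resolventSum (fun j => ⟪b j, e⟫ ^ 2) μ) z - ⟪e, B e⟫ := by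
  have hl := summable_sq_eigenvalues_compression hsym b hb hμ he f hf
  have hz0 : z ≠ 0 := by rintro rfl; simp at hz
  have hc0 : ∀ j, 0 ≤ ⟪b j, e⟫ ^ 2 := fun j => sq_nonneg _
  have hc := b.hasSum_inner_sq e
  rw [he, one_pow] at hc
  have hreg : ∀ {ν : ℕ → ℝ}, Summable (fun i => ν i ^ 2) →
      HasSum (fun i => (1 - z * ν i)⁻¹ - 1 - z * ν i) (-z * logDeriv (regularizedProd ν) z) :=
    fun {ν} hν => by
      refine ((logDeriv_regularizedProd hν hδ fun i => hUδ z hzU _).mul_left (-z)).congr_fun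
        fun i => ?_
      have h := mul_inv_cancel₀ (one_sub_mul_ofReal_ne_zero hz (ν i))
      rw [div_eq_mul_inv]
      linear_combination h
  have hg := resolventSum_ne_zero (μ := μ) hc0 hc hz
  have hG := (summable_resolventSum hc0 hc.summable hδ fun j => hUδ z hzU (μ j)).hasSum
  change HasSum _ (resolventSum (fun j => ⟪b j, e⟫ ^ 2) μ z) at hG
  have hq := hasSum_resolventSum_add_mul_deriv hc0 hc.summable hδ hU
    (fun z hz j => hUδ z hz (μ j)) hzU
  have h := (hreg hl).unique (hasSum_regularized_resolvent_compression hsym hb he hf hδ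
    (fun j => hUδ z hzU _) (fun i => one_sub_mul_ofReal_ne_zero hz _) hg (hreg hμ)
    (by simpa using hG) (by simpa using hq))
  rw [logDeriv_apply (f := resolventSum _ _)]
  rw [add_div, div_self hg, mul_div_assoc] at h
  exact mul_left_cancel₀ (neg_ne_zero.2 hz0) (by linear_combination h)

/-- Constancy in the upper half-plane of the quotient of the two sides of Cramer's rule, evaluated
at the two points `iε` and `1 + iε`. -/
lemma regularizedProd_mul_resolventSum_eq (hsym : ∀ f g : H, ⟪B f, g⟫ = ⟪f, B g⟫)
    (hb : ∀ i, B (b i) = μ i • b i) (hμ : Summable fun i => μ i ^ 2) (he : ‖e‖ = 1)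
    (hf : ∀ i, (projPerp e).comp (B.comp (projPerp e)) (f i) = l i • f i) {z w : ℂ}
    (hz : 0 < z.im) (hw : 0 < w.im) :
    regularizedProd μ z * resolventSum (fun j => ⟪b j, e⟫ ^ 2) μ z *
        Complex.exp (-(z * ⟪e, B e⟫)) * regularizedProd l w =
      regularizedProd μ w * resolventSum (fun j => ⟪b j, e⟫ ^ 2) μ w *
        Complex.exp (-(w * ⟪e, B e⟫)) * regularizedProd l z := by
  have hl := summable_sq_eigenvalues_compression hsym b hb hμ he f hf
  have hc0 : ∀ j, 0 ≤ ⟪b j, e⟫ ^ 2 := fun j => sq_nonneg _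
  have hc := b.hasSum_inner_sq e
  rw [he, one_pow] at hc
  set r := min z.im w.im / 2 with hr
  set R := max ‖z‖ ‖w‖ + 1 with hR
  have hr0 : 0 < r := half_pos (lt_min hz hw)
  have hR0 : 0 < R := by positivity
  let U : Set ℂ := {x | r < x.im} ∩ Metric.ball 0 R
  have hU : IsOpen U := (isOpen_lt continuous_const Complex.continuous_im).inter Metric.isOpen_ball
  have hUc : Convex ℝ U := (convex_halfSpace_im_gt r).inter (convex_ball 0 R)
  have hUim : ∀ x ∈ U, 0 < x.im := fun x hx => hr0.trans hx.1
  have hδ : 0 < r / R := div_pos hr0 hR0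
  have hUδ : ∀ x ∈ U, ∀ y : ℝ, r / R ≤ ‖1 - x * y‖ := fun x hx y => by
    refine le_trans ?_ (im_div_norm_le_norm_one_sub_mul_ofReal (hUim x hx) y)
    have hx0 : x ≠ 0 := by rintro rfl; simpa using hUim _ hx
    have h1 : r < x.im := hx.1
    have h2 : ‖x‖ < R := by simpa using hx.2
    exact div_le_div₀ (hUim x hx).le h1.le (norm_pos_iff.2 hx0) h2.le
  have hzU : z ∈ U := ⟨by
    have := min_le_left z.im w.im
    simp only [Set.mem_ofPred_eq]; linarith, by
    have := le_max_left ‖z‖ ‖w‖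
    simp only [mem_ball_zero_iff]; linarith⟩
  have hwU : w ∈ U := ⟨by
    have := min_le_right z.im w.im
    simp only [Set.mem_ofPred_eq]; linarith, by
    have := le_max_right ‖z‖ ‖w‖
    simp only [mem_ball_zero_iff]; linarith⟩
  have hgd := differentiableOn_resolventSum hc0 hc.summable hδ hU fun x hx j => hUδ x hx (μ j)
  have hD0 : ∀ {ν : ℕ → ℝ}, Summable (fun i => ν i ^ 2) → ∀ x ∈ U, regularizedProd ν x ≠ 0 :=
    fun hν x hx => regularizedProd_ne_zero hν fun i => one_sub_mul_ofReal_ne_zero (hUim x hx) _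
  let F : ℂ → ℂ := fun x => regularizedProd μ x * resolventSum (fun j => ⟪b j, e⟫ ^ 2) μ x *
    Complex.exp (-(x * ⟪e, B e⟫)) / regularizedProd l x
  have hF : ∀ x ∈ U, HasDerivAt F 0 x := fun x hx => by
    have h1 := (differentiable_regularizedProd hμ x).hasDerivAt
    have h2 := (hgd.differentiableAt (hU.mem_nhds hx)).hasDerivAt
    have h3 : HasDerivAt (fun x : ℂ => Complex.exp (-(x * ⟪e, B e⟫)))
        (Complex.exp (-(x * ⟪e, B e⟫)) * -(1 * (⟪e, B e⟫ : ℂ))) x :=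
      ((hasDerivAt_id x).mul_const (⟪e, B e⟫ : ℂ)).neg.cexp
    have h4 := (differentiable_regularizedProd hl x).hasDerivAt
    refine (((h1.fun_mul h2).fun_mul h3).fun_div h4 (hD0 hl x hx)).congr_deriv ?_
    have hlog := logDeriv_resolventSum_compression hsym hb hμ he hf hδ hU hUδ hx (hUim x hx)
    simp only [logDeriv_apply] at hlog
    have n1 := hD0 hμ x hx
    have n2 := resolventSum_ne_zero (μ := μ) hc0 hc (hUim x hx)
    have n4 := hD0 hl x hx
    rw [div_eq_iff n4] at hlog
    rw [hlog, div_eq_zero_iff]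
    left
    field_simp
    ring
  have hconst := hU.is_const_of_deriv_eq_zero hUc.isPreconnected
    (fun x hx => (hF x hx).differentiableAt.differentiableWithinAt)
    (fun x hx => (hF x hx).deriv) hzU hwU
  exact (div_eq_div_iff (hD0 hl z hzU) (hD0 hl w hwU)).1 hconst

lemma exists_le_abs_one_sub_eigenvalue (hb : ∀ i, B (b i) = μ i • b i) (hinv : IsUnit (1 - B)) :
    ∃ δ : ℝ, 0 < δ ∧ δ ≤ 1 ∧ ∀ j, δ ≤ |1 - μ j| := by
  refine ⟨(‖Ring.inverse (1 - B)‖ + 1)⁻¹, by positivity,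
    inv_le_one_of_one_le₀ (by linarith [norm_nonneg (Ring.inverse (1 - B))]), fun j => ?_⟩
  have h : Ring.inverse (1 - B) ((1 - μ j) • b j) = b j := by
    have h := congrArg (fun T : H →L[ℝ] H => T (b j)) (Ring.inverse_mul_cancel _ hinv)
    simpa [hb, sub_smul] using h
  have h1 := (Ring.inverse (1 - B)).le_opNorm ((1 - μ j) • b j)
  rw [h, norm_smul, b.orthonormal.1 j, mul_one, Real.norm_eq_abs] at h1
  rw [inv_le_iff_one_le_mul₀' (by positivity)]
  nlinarith [abs_nonneg (1 - μ j)]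

lemma resolventSum_one (hsym : ∀ f g : H, ⟪B f, g⟫ = ⟪f, B g⟫)
    (hb : ∀ i, B (b i) = μ i • b i) (hinv : IsUnit (1 - B)) (hμ1 : ∀ j, 1 - μ j ≠ 0) :
    resolventSum (fun j => ⟪b j, e⟫ ^ 2) μ 1 = (⟪e, Ring.inverse (1 - B) e⟫ : ℝ) := by
  refine HasSum.tsum_eq ((Complex.hasSum_ofReal.2
    (b.hasSum_inner_mul_inner e (Ring.inverse (1 - B) e))).congr_fun fun j => ?_)
  have h := congrArg (fun T : H →L[ℝ] H => ⟪b j, T e⟫) (Ring.mul_inverse_cancel _ hinv)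
  simp only [mul_apply_eq_comp, sub_apply, one_apply_eq_self, inner_sub_right,
    inner_apply_of_eigenvector hsym (hb j)] at h
  rw [real_inner_comm (b j) e, one_mul]
  norm_cast
  rw [div_eq_iff (hμ1 j)]
  linear_combination -⟪b j, e⟫ * h

/-- Cramer's rule in terms of the eigenvalues of `B` and of its compression. -/
lemma regularizedProd_one_mul_inner (hsym : ∀ f g : H, ⟪B f, g⟫ = ⟪f, B g⟫)
    (hb : ∀ i, B (b i) = μ i • b i) (hμ : Summable fun i => μ i ^ 2) (he : ‖e‖ = 1)
    (hf : ∀ i, (projPerp e).comp (B.comp (projPerp e)) (f i) = l i • f i)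
    (hinv : IsUnit (1 - B)) :
    (∏' i, (1 - μ i) * Real.exp (μ i)) * ⟪e, Ring.inverse (1 - B) e⟫ * Real.exp (-⟪e, B e⟫) =
      ∏' i, (1 - l i) * Real.exp (l i) := by
  have hl := summable_sq_eigenvalues_compression hsym b hb hμ he f hf
  have hc0 : ∀ j, 0 ≤ ⟪b j, e⟫ ^ 2 := fun j => sq_nonneg _
  have hc := b.hasSum_inner_sq e
  rw [he, one_pow] at hc
  obtain ⟨δ, hδ, hδ1, hδμ⟩ := exists_le_abs_one_sub_eigenvalue hb hinv
  have hu0 : Filter.Tendsto (fun x : ℝ => (x : ℂ) * Complex.I) (nhdsWithin 0 (Set.Ioi 0))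
      (nhds 0) := by
    refine (Continuous.tendsto' (by fun_prop) 0 0 (by simp)).mono_left nhdsWithin_le_nhds
  have hu1 : Filter.Tendsto (fun x : ℝ => 1 + (x : ℂ) * Complex.I) (nhdsWithin 0 (Set.Ioi 0))
      (nhds 1) := by
    simpa using hu0.const_add 1
  have hb0 : ∀ (x : ℝ) j, δ ≤ ‖1 - (x : ℂ) * Complex.I * μ j‖ := fun x j => by
    refine hδ1.trans (le_trans ?_ (Complex.abs_re_le_norm _))
    simp
  have hb1 : ∀ (x : ℝ) j, δ ≤ ‖1 - (1 + (x : ℂ) * Complex.I) * μ j‖ := fun x j => by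
    refine (hδμ j).trans (le_trans (le_of_eq ?_) (Complex.abs_re_le_norm _))
    simp
  have hg0 := tendsto_resolventSum hc0 hc.summable hδ hu0 (.of_forall fun x => hb0 x)
    (fun j => by simpa using hb0 0 j)
  have hg1 := tendsto_resolventSum hc0 hc.summable hδ hu1 (.of_forall fun x => hb1 x)
    (fun j => by simpa using hb1 0 j)
  have hD : ∀ {ν : ℕ → ℝ}, Summable (fun i => ν i ^ 2) → Continuous (regularizedProd ν) :=
    fun hν => (differentiable_regularizedProd hν).continuous
  have hE : Continuous fun x : ℂ => Complex.exp (-(x * ⟪e, B e⟫)) := by fun_prop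
  have hleft := ((((hD hμ).tendsto 1).comp hu1).mul hg1).mul ((hE.tendsto 1).comp hu1)
    |>.mul (((hD hl).tendsto 0).comp hu0)
  have hright := ((((hD hμ).tendsto 0).comp hu0).mul hg0).mul ((hE.tendsto 0).comp hu0)
    |>.mul (((hD hl).tendsto 1).comp hu1)
  have hlim := tendsto_nhds_unique (hleft.congr' (by
    filter_upwards [self_mem_nhdsWithin] with x hx
    have hx : 0 < x := hx
    exact regularizedProd_mul_resolventSum_eq hsym hb hμ he hf (by simpa using hx)
      (by simpa using hx))) hright
  have hr0 : resolventSum (fun j => ⟪b j, e⟫ ^ 2) μ 0 = 1 := by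
    simpa [resolventSum] using (Complex.hasSum_ofReal.2 hc).tsum_eq
  have hμ1 : ∀ j, 1 - μ j ≠ 0 := fun j => abs_pos.1 (hδ.trans_le (hδμ j))
  rw [hr0, resolventSum_one hsym hb hinv hμ1, regularizedProd_zero, regularizedProd_zero,
    regularizedProd_one hμ, regularizedProd_one hl, zero_mul, neg_zero, Complex.exp_zero,
    one_mul, one_mul, one_mul, one_mul, mul_one] at hlim
  exact_mod_cast hlim

end CramerRule

/-- Generalized Cramer's rule for Carleman–Fredholm determinants: for a self-adjoint
Hilbert–Schmidt `B` with `Id - B` invertible and a unit vector `e` with `P` the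
projection onto `e^⊥`,
`⟨e, (Id - B)⁻¹ e⟩ = (det₂(Id - P B P) / det₂(Id - B)) · exp(⟨e, B e⟩)`. -/
theorem cramer_rule_carleman_fredholm
    {H : Type*} [NormedAddCommGroup H] [InnerProductSpace ℝ H] [CompleteSpace H]
    (B : H →L[ℝ] H) (hsym : ∀ f g : H, ⟪B f, g⟫ = ⟪f, B g⟫)
    (hhs : IsHilbertSchmidtDiag B) (hinv : IsUnit (1 - B))
    (e : H) (he : ‖e‖ = 1) :
    ⟪e, Ring.inverse (1 - B) e⟫
      = (carlemanFredholmDet ((projPerp e).comp (B.comp (projPerp e)))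
          / carlemanFredholmDet B) * Real.exp ⟪e, B e⟫ := by
  have hC := isHilbertSchmidtDiag_compression hsym hhs he
  rw [carlemanFredholmDet, carlemanFredholmDet, dif_pos hC, dif_pos hhs]
  obtain ⟨hb, hμ⟩ := hhs.choose_spec
  rw [← regularizedProd_one_mul_inner hsym hb hμ he hC.choose_spec.1 hinv, Real.exp_neg]
  have h0 : ∏' i, (1 - hhs.choose.2 i) * Real.exp (hhs.choose.2 i) ≠ 0 := by
    obtain ⟨δ, hδ, -, hδμ⟩ := exists_le_abs_one_sub_eigenvalue hb hinv
    have h := regularizedProd_ne_zero (z := 1) hμ fun i => by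
      rw [one_mul]
      exact_mod_cast abs_pos.1 (hδ.trans_le (hδμ i))
    rw [regularizedProd_one hμ] at h
    exact_mod_cast h
  field_simp
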